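/- For any index k = (k_1,…,k_r) of positive integers and any positive integer N, the multiple star harmonic sum ζ^⋆_{<N}(k) = ∑_{0<m_1≤⋯≤m_r<N} ∏_i 1/m_i^{k_i} equals ζ^{⋆♭}_{<N}(k) = ∑ ∏_{i=1}^r 1/((N-n_{i1}) n_{i2} ⋯ n_{i k_i}), where the sum runs over n_{ij} ∈ [1,N-1] with n_{i1} ≤ ⋯ ≤ n_{i k_i} for each i and n_{(i-1)1} ≤ n_{i k_i} for 2 ≤ i ≤ r. -/

import Mathlib

/-- Auxiliary recursion: `zetaStarAux M t` sums over `0 < m₁ ≤ ⋯ ≤ m_r < M` where the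
exponent list `t` lists the exponents from the *largest* variable downwards. -/
def zetaStarAux : ℕ → List ℕ → ℚ
  | _, [] => 1
  | M, k :: t => ∑ m ∈ Finset.Ioo 0 M, (1 / (m : ℚ) ^ k) * zetaStarAux (m + 1) t

/-- The multiple star harmonic sum `ζ⋆_{<N}(k₁,…,k_r) = ∑_{0<m₁≤⋯≤m_r<N} ∏ᵢ 1/mᵢ^{kᵢ}`. -/
def zetaStar (N : ℕ) (ks : List ℕ) : ℚ := zetaStarAux N ks.reverse

/-- Auxiliary recursion for the ⋆♭-sum.  `sfAux N lo hi j t` sums over the remaining `j`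
variables of the current block, going downwards from the top: the current variable ranges
over `[lo, hi]`; the bottom variable of a block carries the factor `1/(N - n)` and its
value is the (inclusive) lower bound for the top variable of the next block
(the condition `n_{(i-1)1} ≤ n_{i k_i}`), whose range goes up to `N - 1`. -/
def sfAux (N : ℕ) : ℕ → ℕ → ℕ → List ℕ → ℚ
  | _, _, 0, [] => 1
  | lo, _, 0, k :: t => sfAux N lo (N - 1) k t
  | lo, hi, 1, t => ∑ n ∈ Finset.Icc lo hi, (1 / ((N : ℚ) - (n : ℚ))) * sfAux N n 0 0 t
  | lo, hi, (j+2), t => ∑ n ∈ Finset.Icc lo hi, (1 / (n : ℚ)) * sfAux N 1 n (j+1) t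
  termination_by _ _ j t => (t.length, j)

/-- The ⋆♭-sum `ζ⋆♭_{<N}(k₁,…,k_r)`: the sum of `∏ᵢ 1/((N-n_{i1})·n_{i2}⋯n_{i k_i})` over
`n_{ij} ∈ [1,N-1]` with `n_{i1} ≤ ⋯ ≤ n_{i k_i}` for each `i` and
`n_{(i-1)1} ≤ n_{i k_i}` for `2 ≤ i ≤ r`. -/
def zetaStarFlat (N : ℕ) (ks : List ℕ) : ℚ := sfAux N 1 (N - 1) 0 ks

/-- The star sum with exponents listed from the largest variable downwards, all variables being
at least `lo`. -/
def zetaStarFrom (lo : ℕ) : ℕ → List ℕ → ℚ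
  | _, [] => 1
  | M, k :: t => ∑ m ∈ Finset.Ico lo M, (1 / (m : ℚ) ^ k) * zetaStarFrom lo (m + 1) t

/-- The star sum over `lo ≤ m₁ ≤ ⋯ ≤ m_r ≤ M` with exponents listed from the smallest variable
upwards. -/
def starTail (M : ℕ) : List ℕ → ℕ → ℚ
  | [], _ => 1
  | k :: t, lo => ∑ m ∈ Finset.Icc lo M, (1 / (m : ℚ) ^ k) * starTail M t m

theorem zetaStarAux_eq_zetaStarFrom (t : List ℕ) (M : ℕ) :
    zetaStarAux M t = zetaStarFrom 1 M t := by
  induction t generalizing M with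
  | nil => rfl
  | cons k t ih =>
    simp only [zetaStarAux, zetaStarFrom, ih]
    exact Finset.sum_congr (by ext; simp [Nat.succ_le_iff]) fun _ _ => rfl

theorem zetaStarFrom_append_singleton (s : List ℕ) (k lo M : ℕ) :
    zetaStarFrom lo M (s ++ [k]) =
      ∑ m ∈ Finset.Ico lo M, (1 / (m : ℚ) ^ k) * zetaStarFrom m M s := by
  induction s generalizing M with
  | nil => simp [zetaStarFrom]
  | cons a s ih =>
    simp only [List.cons_append, zetaStarFrom, ih, Finset.mul_sum]
    rw [Finset.sum_comm' (t' := Finset.Ico lo M) (s' := fun m => Finset.Ico m M)]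
    · exact Finset.sum_congr rfl fun _ _ => Finset.sum_congr rfl fun _ _ => by ring
    · intro x y
      simp only [Finset.mem_Ico]
      omega

theorem zetaStarFrom_reverse (t : List ℕ) (M lo : ℕ) :
    zetaStarFrom lo (M + 1) t.reverse = starTail M t lo := by
  induction t generalizing lo with
  | nil => simp [zetaStarFrom, starTail]
  | cons k t ih =>
    rw [List.reverse_cons, zetaStarFrom_append_singleton]
    simp only [ih, starTail]
    exact Finset.sum_congr (by ext; simp) fun _ _ => rfl

/-- The matrix whose columns are suitably normalized eigenvectors of the Cesàro operator. -/
def cesaroKernel (M n m : ℕ) : ℚ := ((n - 1).choose (m - 1) : ℚ) / (M.choose m : ℚ)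

theorem cast_choose_succ_right_mul (a b : ℕ) :
    (a.choose (b + 1) : ℚ) * (b + 1) = a.choose b * ((a : ℚ) - b) := by
  rcases lt_or_ge a b with h | h
  · simp [Nat.choose_eq_zero_of_lt h, Nat.choose_eq_zero_of_lt (h.trans (Nat.lt_succ_self b))]
  · have := Nat.choose_succ_right_eq a b
    rw [← Nat.cast_sub h]
    exact_mod_cast this

/-- Each column of `cesaroKernel` is an eigenvector of the Cesàro operator. -/
theorem sum_cesaroKernel_Icc_one (M n m : ℕ) (hm : 1 ≤ m) :
    ∑ i ∈ Finset.Icc 1 n, cesaroKernel M i m = n * (1 / (m : ℚ)) * cesaroKernel M n m := by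
  obtain ⟨b, rfl⟩ : ∃ b, m = b + 1 := ⟨m - 1, by omega⟩
  rcases Nat.eq_zero_or_pos n with rfl | hn
  · simp
  have key (k : ℕ) : ∑ i ∈ Finset.Icc 1 k, ((i - 1).choose b : ℚ) = k.choose (b + 1) := by
    induction k with
    | zero => simp
    | succ k ih =>
      rw [Finset.sum_Icc_succ_top (by omega), ih, Nat.choose_succ_succ]
      push_cast
      simp [add_comm]
  obtain ⟨a, rfl⟩ : ∃ a, n = a + 1 := ⟨n - 1, by omega⟩
  simp only [cesaroKernel, ← Finset.sum_div, Nat.add_sub_cancel, key]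
  have h : ((a : ℚ) + 1) * a.choose b = (a + 1).choose (b + 1) * (b + 1) := by
    exact_mod_cast Nat.add_one_mul_choose_eq a b
  have hb : (b : ℚ) + 1 ≠ 0 := by positivity
  have h' : ((a + 1).choose (b + 1) : ℚ) = ((a : ℚ) + 1) * (1 / (b + 1)) * a.choose b := by
    field_simp
    linear_combination -h
  rw [h']
  push_cast
  ring

theorem cesaroKernel_succ_sub (M n j : ℕ) (hn : 1 ≤ n) (hj : 1 ≤ j) (hjM : j + 1 ≤ M) :
    cesaroKernel M n (j + 1) - cesaroKernel M n j =
      ((M : ℚ) + 1 - n) * (1 / ((j + 1 : ℕ) : ℚ)) * cesaroKernel M n (j + 1)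
        - ((M : ℚ) - n) * (1 / ((j + 1 : ℕ) : ℚ)) * cesaroKernel M (n + 1) (j + 1) := by
  obtain ⟨b, rfl⟩ : ∃ b, j = b + 1 := ⟨j - 1, by omega⟩
  obtain ⟨a, rfl⟩ : ∃ a, n = a + 1 := ⟨n - 1, by omega⟩
  simp only [cesaroKernel, Nat.add_sub_cancel, Nat.choose_succ_succ a b]
  have hP : (M.choose (b + 1) : ℚ) ≠ 0 := by
    exact_mod_cast (Nat.choose_pos (by omega)).ne'
  have hQ : (M.choose (b + 1 + 1) : ℚ) ≠ 0 := by
    exact_mod_cast (Nat.choose_pos hjM).ne'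
  have hM : (M : ℚ) - (b + 1) ≠ 0 := by
    rw [sub_ne_zero]
    exact_mod_cast (by omega : M ≠ b + 1)
  have h1 := cast_choose_succ_right_mul M (b + 1)
  have h2 := cast_choose_succ_right_mul a b
  push_cast at h1 ⊢
  have hb : (b : ℚ) + 1 + 1 ≠ 0 := by positivity
  have h3 : (M.choose (b + 1 + 1) : ℚ) = M.choose (b + 1) * (M - (b + 1)) / (b + 1 + 1) := by
    rw [eq_div_iff hb, h1]
  rw [h3]
  field_simp
  linear_combination h2

theorem sum_cesaroKernel_Icc (M j lo : ℕ) (hj : 1 ≤ j) (hjM : j ≤ M) (hlo : 1 ≤ lo)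
    (hloM : lo ≤ M + 1) :
    ∑ n ∈ Finset.Icc lo M, cesaroKernel M n j =
      ((M : ℚ) + 1 - lo) * ∑ m ∈ Finset.Icc 1 j, (1 / (m : ℚ)) * cesaroKernel M lo m := by
  induction j, hj using Nat.le_induction with
  | base =>
    simp [cesaroKernel, Nat.cast_sub hloM]
  | succ j hj ih =>
    rw [Finset.sum_Icc_succ_top (by omega), mul_add, ← ih (by omega), ← sub_eq_iff_eq_add',
      ← Finset.sum_sub_distrib]
    clear ih
    induction hloM using Nat.decreasingInduction with
    | self => simp
    | of_succ lo h ih =>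
      have hle : lo ≤ M := by omega
      rw [← Finset.add_sum_Ioc_eq_sum_Icc hle, ← Finset.Icc_add_one_left_eq_Ioc, ih (by omega),
        cesaroKernel_succ_sub M lo j hlo hj hjM]
      push_cast
      ring

/-- The operator carrying tails of star sums to tails of flat sums. -/
def starTransform (M : ℕ) (f : ℕ → ℚ) (n : ℕ) : ℚ :=
  ((M : ℚ) + 1 - n) * ∑ m ∈ Finset.Icc 1 M, (1 / (m : ℚ)) * cesaroKernel M n m * f m

theorem starTransform_sum_Icc (M : ℕ) (f : ℕ → ℚ) (lo : ℕ) (hlo : 1 ≤ lo) (hloM : lo ≤ M + 1) :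
    starTransform M (fun a => ∑ m ∈ Finset.Icc a M, f m) lo =
      ∑ n ∈ Finset.Icc lo M, ∑ m ∈ Finset.Icc 1 M, cesaroKernel M n m * f m := by
  rw [Finset.sum_comm]
  simp only [starTransform, Finset.mul_sum]
  rw [Finset.sum_comm' (t' := Finset.Icc 1 M) (s' := fun m => Finset.Icc 1 m)]
  · refine Finset.sum_congr rfl fun m hm => ?_
    rw [Finset.mem_Icc] at hm
    rw [← Finset.sum_mul, sum_cesaroKernel_Icc M m lo hm.1 hm.2 hlo hloM, Finset.mul_sum,
      Finset.sum_mul]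
    exact Finset.sum_congr rfl fun _ _ => by ring
  · intro x y
    simp only [Finset.mem_Icc]
    omega

theorem starTransform_one (M lo : ℕ) (hlo : 1 ≤ lo) (hloM : lo ≤ M) :
    starTransform M (fun _ => 1) lo = 1 := by
  simp only [starTransform, mul_one]
  rw [← sum_cesaroKernel_Icc M M lo (hlo.trans hloM) le_rfl hlo (by omega),
    Finset.sum_eq_single_of_mem M (by simp [hloM])]
  · simp [cesaroKernel]
  · intro n hn hne
    rw [Finset.mem_Icc] at hn
    simp [cesaroKernel, Nat.choose_eq_zero_of_lt (by omega : n - 1 < M - 1)]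

theorem starTransform_apply_one (M : ℕ) (hM : 1 ≤ M) (f : ℕ → ℚ) :
    starTransform M f 1 = f 1 := by
  rw [starTransform, Finset.sum_eq_single_of_mem 1 (by simp [hM])]
  · have : (M : ℚ) ≠ 0 := by positivity
    simp [cesaroKernel]
    field_simp
  · intro n hn hne
    rw [Finset.mem_Icc] at hn
    simp [cesaroKernel, Nat.choose_eq_zero_of_lt (by omega : 0 < n - 1)]

theorem sfAux_succ_eq_sum (M : ℕ) (t : List ℕ) (f : ℕ → ℚ)
    (ht : ∀ n, 1 ≤ n → n ≤ M → sfAux (M + 1) n 0 0 t = starTransform M f n)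
    (j lo hi : ℕ) (hlo : 1 ≤ lo) (hhi : hi ≤ M) :
    sfAux (M + 1) lo hi (j + 1) t = ∑ n ∈ Finset.Icc lo hi, ∑ m ∈ Finset.Icc 1 M,
      cesaroKernel M n m * ((1 / (m : ℚ) ^ (j + 1)) * f m) := by
  induction j generalizing lo hi with
  | zero =>
    rw [sfAux]
    refine Finset.sum_congr rfl fun n hn => ?_
    rw [Finset.mem_Icc] at hn
    have hne : (M : ℚ) + 1 - n ≠ 0 := by
      rw [sub_ne_zero]
      exact_mod_cast (by omega : M + 1 ≠ n)
    rw [ht n (by omega) (by omega), starTransform, Nat.cast_succ, ← mul_assoc,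
      one_div_mul_cancel hne, one_mul]
    exact Finset.sum_congr rfl fun _ _ => by ring
  | succ j ih =>
    rw [sfAux]
    refine Finset.sum_congr rfl fun n hn => ?_
    rw [Finset.mem_Icc] at hn
    rw [ih 1 n le_rfl (by omega), Finset.sum_comm, Finset.mul_sum]
    refine Finset.sum_congr rfl fun m hm => ?_
    rw [Finset.mem_Icc] at hm
    rw [← Finset.sum_mul, sum_cesaroKernel_Icc_one M n m hm.1]
    have hn0 : (n : ℚ) ≠ 0 := by exact_mod_cast (by omega : n ≠ 0)
    have hm0 : (m : ℚ) ≠ 0 := by exact_mod_cast (by omega : m ≠ 0)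
    field_simp
    ring

theorem sfAux_cons_eq_sum (M lo hi k : ℕ) (t : List ℕ) (f : ℕ → ℚ) (hk : 0 < k)
    (ht : ∀ n, 1 ≤ n → n ≤ M → sfAux (M + 1) n 0 0 t = starTransform M f n) (hlo : 1 ≤ lo)
    (hloM : lo ≤ M + 1) :
    sfAux (M + 1) lo hi 0 (k :: t) =
      starTransform M (fun a => ∑ m ∈ Finset.Icc a M, (1 / (m : ℚ) ^ k) * f m) lo := by
  obtain ⟨j, rfl⟩ : ∃ j, k = j + 1 := ⟨k - 1, by omega⟩
  rw [sfAux, Nat.add_sub_cancel, sfAux_succ_eq_sum M t f ht j lo M hlo le_rfl,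
    starTransform_sum_Icc M _ lo hlo hloM]

theorem sfAux_eq_starTransform (M : ℕ) (t : List ℕ) (h : ∀ a ∈ t, 0 < a) (lo hi : ℕ)
    (hlo : 1 ≤ lo) (hloM : lo ≤ M) :
    sfAux (M + 1) lo hi 0 t = starTransform M (starTail M t) lo := by
  induction t generalizing lo hi with
  | nil => rw [sfAux]; exact (starTransform_one M lo hlo hloM).symm
  | cons k t ih =>
    rw [List.forall_mem_cons] at h
    exact sfAux_cons_eq_sum M lo hi k t _ h.1 (fun n hn hnM => ih h.2 n 0 hn hnM) hlo (by omega)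

/-- The star version of the MSW formula: `ζ⋆_{<N}(k) = ζ⋆♭_{<N}(k)` for every index `k`
(a finite tuple of positive integers) and every integer `N > 0`. -/
theorem MSW_star_formula (N : ℕ) (hN : 0 < N) (ks : List ℕ) (hks : ∀ a ∈ ks, 0 < a) :
    zetaStar N ks = zetaStarFlat N ks := by
  obtain ⟨M, rfl⟩ : ∃ M, N = M + 1 := ⟨N - 1, by omega⟩
  rw [zetaStar, zetaStarFlat, zetaStarAux_eq_zetaStarFrom, zetaStarFrom_reverse]
  rcases Nat.eq_zero_or_pos M with rfl | hM
  · cases ks with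
    | nil => simp [starTail, sfAux]
    | cons k t =>
      obtain ⟨j, rfl⟩ : ∃ j, k = j + 1 := ⟨k - 1, by have := hks k (by simp); omega⟩
      cases j <;> simp [starTail, sfAux]
  · rw [sfAux_eq_starTransform M ks hks 1 _ le_rfl hM, starTransform_apply_one M hM]
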